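/- Let d ≥ 2 and q be an odd prime power with d ≡ 0 (mod 4), or d ≡ 2 (mod 4) and q ≡ 1 (mod 4). Then for every set A ⊆ F_q^d, one has (as an inequality of real numbers) SQ(A) + ZR(A) ≤ |A|²/2 + |A|²/(2q) + q^{d/2}·|A|/2 − q^{(d−2)/2}·|A|/2. -/

import Mathlib

open Finset

/-- `‖x‖ = x₁² + ⋯ + x_d²` for `x ∈ F_q^d`. -/
def normSq {d : ℕ} {F : Type} [Field F] [Fintype F] (x : Fin d → F) : F := ∑ i, x i ^ 2

/-- `SQ(A)` : the number of pairs `(x,y) ∈ A×A` with `η(‖x−y‖) = 1`,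
where `η` is the quadratic character of `F` (with `η(0) = 0`). -/
noncomputable def SQpairs {d : ℕ} {F : Type} [Field F] [Fintype F] [DecidableEq F]
    (A : Finset (Fin d → F)) : ℕ :=
  ((A ×ˢ A).filter (fun p => quadraticChar F (normSq (p.1 - p.2)) = 1)).card

/-- `ZR(A)` : the number of pairs `(x,y) ∈ A×A` with `‖x−y‖ = 0`. -/
def ZRpairs {d : ℕ} {F : Type} [Field F] [Fintype F] [DecidableEq F]
    (A : Finset (Fin d → F)) : ℕ :=
  ((A ×ˢ A).filter (fun p => normSq (p.1 - p.2) = 0)).card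

lemma exists_isPrimitive_addChar (F : Type) [Field F] [Fintype F] :
    ∃ ψ : AddChar F ℂ, ψ.IsPrimitive := by
  obtain ⟨ψ, hψ⟩ := AddChar.exists_apply_ne_zero.mpr (one_ne_zero (α := F))
  exact ⟨ψ, .of_ne_one fun h => hψ (by simp [h])⟩

lemma addChar_sum {ι : Type*} {R M : Type*} [AddCommMonoid R] [CommMonoid M] (ψ : AddChar R M)
    (s : Finset ι) (f : ι → R) : ψ (∑ i ∈ s, f i) = ∏ i ∈ s, ψ (f i) := by
  classical
  induction s using Finset.induction_on with
  | empty => simp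
  | insert i s hi ih => simp [hi, AddChar.map_add_eq_mul, ih]

lemma sum_addChar_dot_sub {d : ℕ} {F : Type} [Field F] [Fintype F] (ψ : AddChar F ℂ)
    (A : Finset (Fin d → F)) (m : Fin d → F) :
    ∑ p ∈ A ×ˢ A, ψ (∑ i, m i * (p.1 - p.2) i) = (‖∑ x ∈ A, ψ (∑ i, m i * x i)‖ ^ 2 : ℝ) := by
  rw [Complex.ofReal_pow, ← Complex.mul_conj', map_sum, Finset.sum_mul_sum, Finset.sum_product]
  refine Finset.sum_congr rfl fun x _ => Finset.sum_congr rfl fun y _ => ?_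
  rw [← AddChar.map_neg_eq_conj, ← AddChar.map_add_eq_mul]
  simp only [Pi.sub_apply, mul_sub, Finset.sum_sub_distrib, ← sub_eq_add_neg]

section QuadraticGaussSums

variable {F : Type} [Field F] [Fintype F] [DecidableEq F]

/-- The quadratic character of `F`, with values in `ℂ`. -/
noncomputable def complexQuadraticChar (F : Type) [Field F] [Fintype F] [DecidableEq F] :
    MulChar F ℂ :=
  (quadraticChar F).ringHomComp (Int.castRingHom ℂ)

lemma complexQuadraticChar_apply (a : F) :
    complexQuadraticChar F a = (quadraticChar F a : ℂ) := rfl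

lemma complexQuadraticChar_isQuadratic : (complexQuadraticChar F).IsQuadratic :=
  (quadraticChar_isQuadratic F).comp _

lemma complexQuadraticChar_ne_one (hF : ringChar F ≠ 2) : complexQuadraticChar F ≠ 1 :=
  (MulChar.ringHomComp_ne_one_iff (RingHom.injective_int _)).mpr (quadraticChar_ne_one hF)

lemma complexQuadraticChar_sq {a : F} (ha : a ≠ 0) : complexQuadraticChar F (a ^ 2) = 1 := by
  rw [complexQuadraticChar_apply, quadraticChar_sq_one' ha, Int.cast_one]

lemma complexQuadraticChar_mul_self {a : F} (ha : a ≠ 0) :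
    complexQuadraticChar F a * complexQuadraticChar F a = 1 := by
  rw [← map_mul, ← sq, complexQuadraticChar_sq ha]

/-- The character sum of the quadratic character twisted by an arbitrary dilate of `ψ`. -/
lemma sum_complexQuadraticChar_mul_addChar (hF : ringChar F ≠ 2) (ψ : AddChar F ℂ) (c : F) :
    ∑ u, complexQuadraticChar F u * ψ (c * u) =
      complexQuadraticChar F c * gaussSum (complexQuadraticChar F) ψ := by
  by_cases hc : c = 0
  · simp [hc, MulChar.sum_eq_zero_of_ne_one (complexQuadraticChar_ne_one hF), MulChar.map_zero]
  · have h := gaussSum_mulShift_eq (complexQuadraticChar F) ψ (Units.mk0 c hc)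
    rw [complexQuadraticChar_isQuadratic.inv] at h
    simpa [gaussSum, AddChar.mulShift_apply] using h

lemma sum_comp_sq (hF : ringChar F ≠ 2) (f : F → ℂ) :
    ∑ x : F, f (x ^ 2) = ∑ y, (complexQuadraticChar F y + 1) * f y := by
  rw [← Finset.sum_fiberwise' univ (fun x : F => x ^ 2) f]
  refine Finset.sum_congr rfl fun y _ => ?_
  have h := quadraticChar_card_sqrts hF y
  rw [Finset.sum_const, nsmul_eq_mul, complexQuadraticChar_apply]
  congr 1
  have h' : ((#{x : F | x ^ 2 = y} : ℕ) : ℤ) = quadraticChar F y + 1 := by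
    rw [← h]; congr 2; ext x; simp
  exact_mod_cast h'

lemma sum_addChar_mul_sq (hF : ringChar F ≠ 2) {ψ : AddChar F ℂ} (hψ : ψ.IsPrimitive) {a : F}
    (ha : a ≠ 0) :
    ∑ x, ψ (a * x ^ 2) = complexQuadraticChar F a * gaussSum (complexQuadraticChar F) ψ := by
  have h := AddChar.sum_mulShift a hψ
  rw [if_neg ha] at h
  rw [sum_comp_sq hF fun y => ψ (a * y), ← sum_complexQuadraticChar_mul_addChar hF]
  simp only [add_mul, one_mul, Finset.sum_add_distrib, mul_comm a]
  simpa using h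

lemma sum_addChar_quadratic (hF : ringChar F ≠ 2) {ψ : AddChar F ℂ} (hψ : ψ.IsPrimitive) {a : F}
    (ha : a ≠ 0) (b : F) :
    ∑ x, ψ (a * x ^ 2 + x * b) =
      complexQuadraticChar F a * gaussSum (complexQuadraticChar F) ψ
        * ψ (-(4 * a)⁻¹ * b ^ 2) := by
  have h2 : (2 : F) ≠ 0 := Ring.two_ne_zero hF
  have h4 : (4 : F) ≠ 0 := by
    have : (4 : F) = 2 * 2 := by norm_num
    simp [this, h2]
  rw [← sum_addChar_mul_sq hF hψ ha, Finset.sum_mul,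
    ← Equiv.sum_comp (Equiv.subRight (b / (2 * a)))]
  refine Finset.sum_congr rfl fun x _ => ?_
  rw [← AddChar.map_add_eq_mul, Equiv.subRight_apply]
  congr 1
  field_simp
  ring

variable {d : ℕ}

lemma sum_addChar_mul_normSq_add (hF : ringChar F ≠ 2) {ψ : AddChar F ℂ} (hψ : ψ.IsPrimitive)
    {a : F} (ha : a ≠ 0) (z : Fin d → F) :
    ∑ m : Fin d → F, ψ (a * normSq m + ∑ i, m i * z i) =
      (complexQuadraticChar F a * gaussSum (complexQuadraticChar F) ψ) ^ d
        * ψ (-(4 * a)⁻¹ * normSq z) := by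
  have h (m : Fin d → F) : ψ (a * normSq m + ∑ i, m i * z i) =
      ∏ i, ψ (a * m i ^ 2 + m i * z i) := by
    rw [normSq, Finset.mul_sum, ← Finset.sum_add_distrib, addChar_sum]
  simp only [h]
  rw [← Fintype.prod_sum fun i x => ψ (a * x ^ 2 + x * z i)]
  simp only [sum_addChar_quadratic hF hψ ha, Finset.prod_mul_distrib, Finset.prod_const,
    Finset.card_univ, Fintype.card_fin, normSq, Finset.mul_sum, addChar_sum, mul_pow]

lemma sum_addChar_dot {ψ : AddChar F ℂ} (hψ : ψ.IsPrimitive) (z : Fin d → F) :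
    ∑ m : Fin d → F, ψ (∑ i, m i * z i) = if z = 0 then (Fintype.card F : ℂ) ^ d else 0 := by
  simp only [addChar_sum]
  rw [← Fintype.prod_sum fun i x => ψ (x * z i)]
  simp only [AddChar.sum_mulShift _ hψ]
  split_ifs with hz
  · simp [hz]
  · obtain ⟨i, hi⟩ := Function.ne_iff.mp hz
    exact Finset.prod_eq_zero (Finset.mem_univ i) (by simp [show z i ≠ 0 from hi])

/-- `η(r) + 1_{r = 0}`. -/
def squareWeight (r : F) : ℤ := quadraticChar F r + if r = 0 then 1 else 0

lemma squareWeight_le_one (r : F) : squareWeight r ≤ 1 := by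
  unfold squareWeight
  split_ifs with h
  · simp [h]
  · rcases quadraticChar_dichotomy h with h | h <;> simp [h]

lemma card_mul_squareWeight (hF : ringChar F ≠ 2) {ψ : AddChar F ℂ} (hψ : ψ.IsPrimitive) (r : F) :
    (Fintype.card F : ℂ) * squareWeight r =
      ∑ s, (1 + complexQuadraticChar F (-s) * gaussSum (complexQuadraticChar F) ψ)
        * ψ (s * r) := by
  have h₁ := AddChar.sum_mulShift r hψ
  have h₂ := sum_complexQuadraticChar_mul_addChar hF ψ (-r)
  rw [← Equiv.sum_comp (Equiv.neg F)] at h₂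
  simp only [Equiv.neg_apply, neg_mul_neg] at h₂
  have h₃ := gaussSum_sq (complexQuadraticChar_ne_one hF) complexQuadraticChar_isQuadratic hψ
  have h₄ : complexQuadraticChar F (-r) * complexQuadraticChar F (-1) =
      complexQuadraticChar F r := by rw [← map_mul, neg_mul_neg, mul_one]
  calc (Fintype.card F : ℂ) * squareWeight r
      = (if r = 0 then (Fintype.card F : ℂ) else 0)
        + complexQuadraticChar F r * Fintype.card F := by
        rw [squareWeight, complexQuadraticChar_apply]
        split_ifs <;> push_cast <;> ring
    _ = ∑ s, ψ (s * r) + gaussSum (complexQuadraticChar F) ψ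
        * ∑ s, complexQuadraticChar F (-s) * ψ (r * s) := by
        rw [h₁, h₂, ← h₄]
        push_cast
        linear_combination (-complexQuadraticChar F (-r)) * h₃
    _ = _ := by
        rw [Finset.mul_sum, ← Finset.sum_add_distrib]
        refine Finset.sum_congr rfl fun s _ => ?_
        rw [mul_comm r s]
        ring

lemma card_mul_squareWeight_neg (hF : ringChar F ≠ 2) {ψ : AddChar F ℂ} (hψ : ψ.IsPrimitive)
    (r : F) :
    (Fintype.card F : ℂ) * squareWeight (-r) =
      ∑ a, (1 + complexQuadraticChar F a * gaussSum (complexQuadraticChar F) ψ)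
        * ψ (a * r) := by
  rw [card_mul_squareWeight hF hψ, ← Equiv.sum_comp (Equiv.neg F)]
  simp

/-- The Fourier transform of `m ↦ η(-‖m‖) + 1_{‖m‖ = 0}` on an even-dimensional space on which
the `2k`-th power of the Gauss sum is `q ^ k`. -/
lemma sum_squareWeight_mul_addChar {k : ℕ} (hF : ringChar F ≠ 2) {ψ : AddChar F ℂ}
    (hψ : ψ.IsPrimitive) (hdk : d = 2 * k)
    (hG : gaussSum (complexQuadraticChar F) ψ ^ d = (Fintype.card F : ℂ) ^ k)
    (z : Fin d → F) :
    (Fintype.card F : ℂ) * ∑ m : Fin d → F, squareWeight (-normSq m) * ψ (∑ i, m i * z i) =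
      (if z = 0 then (Fintype.card F : ℂ) ^ d else 0)
        + (Fintype.card F : ℂ) ^ k * (Fintype.card F * squareWeight (normSq z) - 1) := by
  have h2 : (2 : F) ≠ 0 := Ring.two_ne_zero hF
  have h4 : (4 : F) ≠ 0 := by
    have : (4 : F) = 2 ^ 2 := by norm_num
    simp [this, h2]
  set G := gaussSum (complexQuadraticChar F) ψ with hGdef
  have hswap : (Fintype.card F : ℂ) *
      ∑ m : Fin d → F, squareWeight (-normSq m) * ψ (∑ i, m i * z i) =
      ∑ a, (1 + complexQuadraticChar F a * G)
        * ∑ m : Fin d → F, ψ (a * normSq m + ∑ i, m i * z i) := by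
    simp only [Finset.mul_sum]
    rw [Finset.sum_comm]
    refine Finset.sum_congr rfl fun m _ => ?_
    rw [← mul_assoc, card_mul_squareWeight_neg hF hψ, Finset.sum_mul]
    refine Finset.sum_congr rfl fun a _ => ?_
    rw [AddChar.map_add_eq_mul, mul_assoc]
  have hterm (a : F) (ha : a ∈ univ.erase (0 : F)) :
      (1 + complexQuadraticChar F a * G)
        * ∑ m : Fin d → F, ψ (a * normSq m + ∑ i, m i * z i) =
      (Fintype.card F : ℂ) ^ k * ((1 + complexQuadraticChar F (-(-(4 * a)⁻¹)) * G)
        * ψ (-(4 * a)⁻¹ * normSq z)) := by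
    have ha : a ≠ 0 := Finset.ne_of_mem_erase ha
    have hη : complexQuadraticChar F (-(-(4 * a)⁻¹)) = complexQuadraticChar F a := by
      have : -(-(4 * a)⁻¹) = a * ((2 * a)⁻¹) ^ 2 := by
        have : (4 : F) = 2 ^ 2 := by norm_num
        rw [this]
        field_simp
      rw [this, map_mul, complexQuadraticChar_sq (inv_ne_zero (mul_ne_zero h2 ha)), mul_one]
    have hpow : complexQuadraticChar F a ^ d = 1 := by
      rw [hdk, pow_mul, sq, complexQuadraticChar_mul_self ha, one_pow]
    rw [sum_addChar_mul_normSq_add hF hψ ha, mul_pow, hpow, ← hGdef, hG, hη]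
    ring
  have hreindex (f : F → ℂ) :
      ∑ a ∈ univ.erase (0 : F), f (-(4 * a)⁻¹) = ∑ s ∈ univ.erase (0 : F), f s := by
    refine Finset.sum_bij' (fun a _ => -(4 * a)⁻¹) (fun a _ => -(4 * a)⁻¹) ?_ ?_ ?_ ?_ ?_
    · simp [h4]
    · simp [h4]
    · intro a ha
      have ha : a ≠ 0 := Finset.ne_of_mem_erase ha
      field_simp
    · intro a ha
      have ha : a ≠ 0 := Finset.ne_of_mem_erase ha
      field_simp
    · simp
  rw [hswap, ← Finset.add_sum_erase _ _ (Finset.mem_univ (0 : F)),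
    Finset.sum_congr rfl hterm, ← Finset.mul_sum,
    hreindex fun s => (1 + complexQuadraticChar F (-s) * G) * ψ (s * normSq z),
    card_mul_squareWeight hF hψ, ← hGdef,
    ← Finset.add_sum_erase _ _ (Finset.mem_univ (0 : F))]
  simp [sum_addChar_dot hψ, MulChar.map_zero]

lemma sum_ite_sub_eq_zero {M : Type*} [AddGroup M] [DecidableEq M] (A : Finset M) (c : ℂ) :
    ∑ p ∈ A ×ˢ A, (if p.1 - p.2 = 0 then c else 0) = A.card * c := by
  simp [Finset.sum_product, sub_eq_zero]

lemma sum_squareWeight_eq (A : Finset (Fin d → F)) :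
    ((∑ p ∈ A ×ˢ A, squareWeight (normSq (p.1 - p.2)) : ℤ) : ℝ) =
      2 * (SQpairs A + ZRpairs A) - (A.card : ℝ) ^ 2 := by
  have h (r : F) : squareWeight r =
      2 * ((if quadraticChar F r = 1 then 1 else 0) + if r = 0 then 1 else 0) - 1 := by
    unfold squareWeight
    by_cases h : r = 0
    · simp [h]
    · rcases quadraticChar_dichotomy h with h' | h' <;> simp [h, h']
  simp only [h, Finset.sum_sub_distrib, ← Finset.mul_sum, Finset.sum_add_distrib, SQpairs, ZRpairs,
    Finset.sum_boole, Finset.sum_const, Finset.card_product, nsmul_eq_mul, mul_one]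
  push_cast
  ring

lemma sum_squareWeight_le {k : ℕ} (hF : ringChar F ≠ 2) {ψ : AddChar F ℂ}
    (hψ : ψ.IsPrimitive) (hdk : d = 2 * k)
    (hG : gaussSum (complexQuadraticChar F) ψ ^ d = (Fintype.card F : ℂ) ^ k)
    (A : Finset (Fin d → F)) :
    (Fintype.card F : ℝ) * (∑ p ∈ A ×ˢ A, squareWeight (normSq (p.1 - p.2)) : ℤ) ≤
      (A.card : ℝ) ^ 2 + ((Fintype.card F : ℝ) ^ (k + 1) - (Fintype.card F : ℝ) ^ k) * A.card := by
  set q : ℝ := (Fintype.card F : ℝ) with hq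
  have hq0 : 0 < q := by simp [hq, Fintype.card_pos]
  set S : (Fin d → F) → ℝ := fun m => ‖∑ x ∈ A, ψ (∑ i, m i * x i)‖ ^ 2 with hS
  set W : ℝ := ((∑ p ∈ A ×ˢ A, squareWeight (normSq (p.1 - p.2)) : ℤ) : ℝ) with hW
  have hparseval : ∑ m, S m = A.card * q ^ d := by
    have : ((∑ m, S m : ℝ) : ℂ) = ((A.card * q ^ d : ℝ) : ℂ) := by
      rw [Complex.ofReal_sum]
      simp only [hS, ← sum_addChar_dot_sub]
      rw [Finset.sum_comm]
      simp only [sum_addChar_dot hψ]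
      rw [sum_ite_sub_eq_zero]
      simp [hq]
    exact_mod_cast this
  have hweighted : q * ∑ m, squareWeight (-normSq m) * S m =
      A.card * q ^ d + q ^ k * (q * W - A.card ^ 2) := by
    have : ((q * ∑ m, squareWeight (-normSq m) * S m : ℝ) : ℂ) =
        ((A.card * q ^ d + q ^ k * (q * W - A.card ^ 2) : ℝ) : ℂ) := by
      rw [Complex.ofReal_mul, Complex.ofReal_sum]
      simp only [hS, Complex.ofReal_mul, ← sum_addChar_dot_sub]
      simp only [Finset.mul_sum]
      rw [Finset.sum_comm]
      have h := fun z : Fin d → F => sum_squareWeight_mul_addChar hF hψ hdk hG z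
      simp only [Finset.mul_sum] at h
      simp only [hq, Complex.ofReal_natCast, Complex.ofReal_intCast, h, Finset.sum_add_distrib,
        sum_ite_sub_eq_zero, ← Finset.mul_sum, Finset.sum_sub_distrib, Finset.sum_const,
        Finset.card_product, hW]
      push_cast
      simp [Finset.mul_sum, sq]
    exact_mod_cast this
  have hle : ∑ m, squareWeight (-normSq m) * S m ≤ ∑ m, S m := by
    refine Finset.sum_le_sum fun m _ => ?_
    have h₁ : (squareWeight (-normSq m) : ℝ) ≤ 1 := by exact_mod_cast squareWeight_le_one _
    exact mul_le_of_le_one_left (by positivity) h₁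
  rw [hparseval] at hle
  have hfin := mul_le_mul_of_nonneg_left hle hq0.le
  have hqd : q ^ d = q ^ k * q ^ k := by rw [hdk, two_mul, pow_add]
  rw [hweighted, hqd] at hfin
  have hk : 0 < q ^ k := pow_pos hq0 k
  refine le_of_mul_le_mul_left ?_ hk
  rw [pow_succ q k]
  linarith

lemma gaussSum_complexQuadraticChar_pow {k : ℕ} (hF : ringChar F ≠ 2) {ψ : AddChar F ℂ}
    (hψ : ψ.IsPrimitive) (hk : Even k ∨ IsSquare (-1 : F)) :
    gaussSum (complexQuadraticChar F) ψ ^ (2 * k) = (Fintype.card F : ℂ) ^ k := by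
  rw [pow_mul, gaussSum_sq (complexQuadraticChar_ne_one hF) complexQuadraticChar_isQuadratic hψ,
    mul_pow]
  have h : complexQuadraticChar F (-1) ^ k = 1 := by
    rcases hk with ⟨j, rfl⟩ | h
    · rw [pow_add, ← mul_pow, complexQuadraticChar_mul_self (by simp), one_pow]
    · rw [complexQuadraticChar_apply, (quadraticChar_one_iff_isSquare (by simp)).mpr h]
      simp
  rw [h, one_mul]

end QuadraticGaussSums

theorem distance_structure_even_plus (q d : ℕ) (F : Type) [Field F] [Fintype F] [DecidableEq F]
    (hcard : Fintype.card F = q) (hodd : Odd q)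
    (hd : d % 4 = 0 ∨ (d % 4 = 2 ∧ q % 4 = 1)) (hd2 : 2 ≤ d)
    (A : Finset (Fin d → F)) :
    (SQpairs A : ℝ) + (ZRpairs A : ℝ) ≤ (A.card : ℝ) ^ 2 / 2 + (A.card : ℝ) ^ 2 / (2 * q)
      + (q : ℝ) ^ (d / 2) * (A.card : ℝ) / 2 - (q : ℝ) ^ ((d - 2) / 2) * (A.card : ℝ) / 2 := by
  have hF : ringChar F ≠ 2 := fun h => by
    have := FiniteField.even_card_iff_char_two.mp h
    have := Nat.odd_iff.mp hodd
    omega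
  obtain ⟨ψ, hψ⟩ := exists_isPrimitive_addChar F
  obtain ⟨k, hk⟩ : ∃ k, d = 2 * (k + 1) := ⟨d / 2 - 1, by omega⟩
  have hsq : Even (k + 1) ∨ IsSquare (-1 : F) := by
    rcases hd with hd | ⟨-, hq⟩
    · left
      rw [Nat.even_iff]
      omega
    · right
      rw [FiniteField.isSquare_neg_one_iff]
      omega
  have hG := gaussSum_complexQuadraticChar_pow hF hψ hsq
  rw [← hk] at hG
  have hmain := sum_squareWeight_le hF hψ hk hG A
  rw [sum_squareWeight_eq, hcard] at hmain
  have hq0 : (0 : ℝ) < q := by exact_mod_cast hodd.pos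
  rw [show d / 2 = k + 1 by omega, show (d - 2) / 2 = k by omega]
  have hid : (A.card : ℝ) ^ 2 / 2 + (A.card : ℝ) ^ 2 / (2 * q)
      + (q : ℝ) ^ (k + 1) * (A.card : ℝ) / 2 - (q : ℝ) ^ k * (A.card : ℝ) / 2 =
      (q * (A.card : ℝ) ^ 2 + ((A.card : ℝ) ^ 2
        + ((q : ℝ) ^ (k + 1 + 1) - (q : ℝ) ^ (k + 1)) * A.card)) / (2 * q) := by
    field_simp
    ring
  rw [hid, le_div_iff₀ (by positivity)]
  linarith
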